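/- Pointwise convergence of the canonical ensemble's coherent-state matrix elements: with H_N = −2J J_x + U J_z² on the N-particle subspace, where J = δ k_B T/N and U = 2ε k_B T/N², the limit lim_{N→∞} ⟨Ψ^N_{θ,φ}| e^{−H_N/k_BT} |Ψ^N_{θ,φ}⟩ = exp(δ sinθ cosφ − (ε/2)cos²θ − ε/2) holds, where δ, ε are held fixed as N → ∞. -/

import Mathlib

open scoped BigOperators
noncomputable section

/-- Two-mode bosonic Fock space: coefficients over number basis `|n₁,n₂⟩`. -/
abbrev Fock : Type := (ℕ × ℕ) →₀ ℂ

/-- Annihilation operator of mode 1: `a₁ |n₁,n₂⟩ = √n₁ |n₁-1,n₂⟩`. -/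
def a1 : Module.End ℂ Fock :=
  Finsupp.lsum ℂ fun m => (Real.sqrt m.1 : ℂ) • Finsupp.lsingle (m.1 - 1, m.2)

/-- Annihilation operator of mode 2. -/
def a2 : Module.End ℂ Fock :=
  Finsupp.lsum ℂ fun m => (Real.sqrt m.2 : ℂ) • Finsupp.lsingle (m.1, m.2 - 1)

/-- Creation operator of mode 1: `a₁† |n₁,n₂⟩ = √(n₁+1) |n₁+1,n₂⟩`. -/
def a1d : Module.End ℂ Fock :=
  Finsupp.lsum ℂ fun m => (Real.sqrt (m.1 + 1) : ℂ) • Finsupp.lsingle (m.1 + 1, m.2)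

/-- Creation operator of mode 2. -/
def a2d : Module.End ℂ Fock :=
  Finsupp.lsum ℂ fun m => (Real.sqrt (m.2 + 1) : ℂ) • Finsupp.lsingle (m.1, m.2 + 1)

/-- Pseudo-spin operators. -/
def Jx : Module.End ℂ Fock := (2 : ℂ)⁻¹ • (a1d * a2 + a2d * a1)
def Jy : Module.End ℂ Fock := (2 * Complex.I)⁻¹ • (a1d * a2 - a2d * a1)
def Jz : Module.End ℂ Fock := (2 : ℂ)⁻¹ • (a1d * a1 - a2d * a2)

/-- Total number operator. -/
def numOp : Module.End ℂ Fock := a1d * a1 + a2d * a2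

/-- Vacuum state `|0,0⟩`. -/
def vacuum : Fock := Finsupp.single (0, 0) 1

/-- Inner product on the Fock space (antilinear in the first argument). -/
def finner (f g : Fock) : ℂ := f.sum fun m c => (starRingEnd ℂ) c * g m

/-- Spin coherent state `|Ψ^N_{θ,φ}⟩`. -/
def coherent (N : ℕ) (θ φ : ℝ) : Fock :=
  ((Real.sqrt N.factorial : ℂ))⁻¹ •
    ((((Real.cos (θ / 2) : ℂ)) • a1d
        + (Complex.exp (Complex.I * φ) * (Real.sin (θ / 2) : ℂ)) • a2d) ^ N) vacuum
/-- Two-site Bose-Hubbard Hamiltonian. -/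
def H_BH (J U : ℝ) : Module.End ℂ Fock :=
  (-(J : ℂ)) • (a1d * a2 + a2d * a1)
    + ((U : ℂ) / 2) • (a1d * a1d * a1 * a1 + a2d * a2d * a2 * a2)

/-- Coherent-state matrix element of `e^{−H/k_BT}`, defined through the
exponential series. -/
def expMatrixEl (kT : ℝ) (H : Module.End ℂ Fock) (ψ : Fock) : ℂ :=
  ∑' j : ℕ, ((j.factorial : ℂ))⁻¹ *
    finner ψ ((((-(kT : ℂ)⁻¹) • H) ^ j) ψ)

theorem a1_single (m : ℕ × ℕ) (c : ℂ) :
    a1 (Finsupp.single m c) = Finsupp.single (m.1 - 1, m.2) ((Real.sqrt m.1 : ℂ) * c) := by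
  simp [a1]
theorem a2_single (m : ℕ × ℕ) (c : ℂ) :
    a2 (Finsupp.single m c) = Finsupp.single (m.1, m.2 - 1) ((Real.sqrt m.2 : ℂ) * c) := by
  simp [a2]
theorem a1d_single (m : ℕ × ℕ) (c : ℂ) :
    a1d (Finsupp.single m c) = Finsupp.single (m.1 + 1, m.2) ((Real.sqrt (m.1 + 1) : ℂ) * c) := by
  simp [a1d]
theorem a2d_single (m : ℕ × ℕ) (c : ℂ) :
    a2d (Finsupp.single m c) = Finsupp.single (m.1, m.2 + 1) ((Real.sqrt (m.2 + 1) : ℂ) * c) := by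
  simp [a2d]

theorem sqrt_mul_self_c (x : ℕ) : ((Real.sqrt ((x:ℝ)+1) : ℂ)) * (Real.sqrt ((x:ℝ)+1) : ℂ) = x + 1 := by
  rw [← Complex.ofReal_mul, Real.mul_self_sqrt (by positivity)]; push_cast; rfl

theorem sqrt_mul_self_c' (x : ℕ) (c : ℂ) :
    ((Real.sqrt ((x:ℝ)+1) : ℂ)) * ((Real.sqrt ((x:ℝ)+1) : ℂ) * c) = (x + 1) * c := by
  rw [← mul_assoc, sqrt_mul_self_c]

theorem ccr11 (f : Fock) : a1 (a1d f) = a1d (a1 f) + f := by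
  induction f using Finsupp.induction_linear with
  | zero => simp
  | add f g hf hg => simp only [map_add, hf, hg]; abel
  | single m c =>
    obtain ⟨m, n⟩ := m
    rcases m with _ | m
    · simp [a1_single, a1d_single]
    · simp only [a1_single, a1d_single, Nat.add_sub_cancel]
      rw [← Finsupp.single_add]
      congr 1
      push_cast
      rw [sqrt_mul_self_c']
      have := sqrt_mul_self_c' (m+1) c
      push_cast at this
      rw [this]; ring

theorem ccr22 (f : Fock) : a2 (a2d f) = a2d (a2 f) + f := by
  induction f using Finsupp.induction_linear with
  | zero => simp
  | add f g hf hg => simp only [map_add, hf, hg]; abel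
  | single m c =>
    obtain ⟨n, m⟩ := m
    rcases m with _ | m
    · simp [a2_single, a2d_single]
    · simp only [a2_single, a2d_single, Nat.add_sub_cancel]
      rw [← Finsupp.single_add]
      congr 1
      push_cast
      rw [sqrt_mul_self_c']
      have := sqrt_mul_self_c' (m+1) c
      push_cast at this
      rw [this]; ring

theorem ccr12 (f : Fock) : a1 (a2d f) = a2d (a1 f) := by
  induction f using Finsupp.induction_linear with
  | zero => simp
  | add f g hf hg => simp only [map_add, hf, hg]
  | single m c => simp only [a1_single, a2d_single]; congr 1; ring

theorem ccr21 (f : Fock) : a2 (a1d f) = a1d (a2 f) := by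
  induction f using Finsupp.induction_linear with
  | zero => simp
  | add f g hf hg => simp only [map_add, hf, hg]
  | single m c => simp only [a2_single, a1d_single]; congr 1; ring

theorem caa (f : Fock) : a1 (a2 f) = a2 (a1 f) := by
  induction f using Finsupp.induction_linear with
  | zero => simp
  | add f g hf hg => simp only [map_add, hf, hg]
  | single m c => simp only [a2_single, a1_single]; congr 1; ring

theorem cdd (f : Fock) : a1d (a2d f) = a2d (a1d f) := by
  induction f using Finsupp.induction_linear with
  | zero => simp
  | add f g hf hg => simp only [map_add, hf, hg]
  | single m c => simp only [a2d_single, a1d_single]; congr 1; ring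

theorem a1_apply (g : Fock) (m : ℕ × ℕ) :
    a1 g m = (Real.sqrt (m.1 + 1) : ℂ) * g (m.1 + 1, m.2) := by
  induction g using Finsupp.induction_linear with
  | zero => simp
  | add f g hf hg => simp only [map_add, Finsupp.add_apply, hf, hg]; ring
  | single n c =>
    obtain ⟨m, m'⟩ := m
    obtain ⟨n, n'⟩ := n
    rw [a1_single]
    rcases n with _ | n
    · simp
    · simp only [Finsupp.single_apply, Nat.add_sub_cancel, Prod.mk.injEq, Nat.add_right_cancel_iff]
      split_ifs with h
      · rw [h.1]; push_cast; rfl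
      · simp

theorem a2_apply (g : Fock) (m : ℕ × ℕ) :
    a2 g m = (Real.sqrt (m.2 + 1) : ℂ) * g (m.1, m.2 + 1) := by
  induction g using Finsupp.induction_linear with
  | zero => simp
  | add f g hf hg => simp only [map_add, Finsupp.add_apply, hf, hg]; ring
  | single n c =>
    obtain ⟨m, m'⟩ := m
    obtain ⟨n', n⟩ := n
    rw [a2_single]
    rcases n with _ | n
    · simp
    · simp only [Finsupp.single_apply, Nat.add_sub_cancel, Prod.mk.injEq, Nat.add_right_cancel_iff]
      split_ifs with h
      · rw [h.2]; push_cast; rfl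
      · simp

theorem finner_single (m : ℕ × ℕ) (c : ℂ) (g : Fock) :
    finner (Finsupp.single m c) g = (starRingEnd ℂ) c * g m := by
  simp [finner]

theorem finner_add_left (f f' g : Fock) : finner (f + f') g = finner f g + finner f' g := by
  unfold finner
  rw [Finsupp.sum_add_index'] <;> intros <;> simp [add_mul]

theorem finner_smul_left (c : ℂ) (f g : Fock) :
    finner (c • f) g = (starRingEnd ℂ) c * finner f g := by
  unfold finner
  rw [Finsupp.sum_smul_index (by simp)]
  simp [Finsupp.sum, Finset.mul_sum, mul_assoc]

theorem finner_add_right (f g g' : Fock) : finner f (g + g') = finner f g + finner f g' := by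
  simp [finner, Finsupp.sum, Finset.sum_add_distrib, mul_add]

theorem finner_symm (f g : Fock) : (starRingEnd ℂ) (finner g f) = finner f g := by
  induction f using Finsupp.induction_linear with
  | zero => simp [finner, Finsupp.sum]
  | add f f' hf hg => rw [finner_add_right, finner_add_left, map_add, hf, hg]
  | single m c =>
    rw [finner_single]
    simp only [finner, Finsupp.sum, map_sum, map_mul, Complex.conj_conj, Finsupp.single_apply]
    by_cases h : m ∈ g.support
    · rw [Finset.sum_eq_single m]
      · simp [mul_comm]
      · intro b _ hb; simp [hb.symm]
      · exact fun h' => absurd h h'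
    · rw [Finsupp.notMem_support_iff.mp h, Finset.sum_eq_zero]
      · simp
      · intro b hb
        have : m ≠ b := fun e => h (e ▸ hb)
        simp [this]

theorem finner_self (f : Fock) : finner f f = ((∑ m ∈ f.support, ‖f m‖ ^ 2 : ℝ) : ℂ) := by
  simp only [finner, Finsupp.sum]
  push_cast
  refine Finset.sum_congr rfl fun m _ => ?_
  rw [mul_comm, Complex.mul_conj']

theorem adj1 (f g : Fock) : finner (a1d f) g = finner f (a1 g) := by
  induction f using Finsupp.induction_linear with
  | zero => simp [finner]
  | add f f' hf hg => rw [map_add, finner_add_left, finner_add_left, hf, hg]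
  | single m c =>
    rw [a1d_single, finner_single, finner_single, a1_apply, map_mul, Complex.conj_ofReal]; ring

theorem adj2 (f g : Fock) : finner (a2d f) g = finner f (a2 g) := by
  induction f using Finsupp.induction_linear with
  | zero => simp [finner]
  | add f f' hf hg => rw [map_add, finner_add_left, finner_add_left, hf, hg]
  | single m c =>
    rw [a2d_single, finner_single, finner_single, a2_apply, map_mul, Complex.conj_ofReal]; ring

@[reducible] def fockCore : InnerProductSpace.Core ℂ Fock where
  inner := finner
  conj_inner_symm := finner_symm
  re_inner_nonneg f := by
    rw [finner_self]
    simp only [RCLike.re_to_complex, Complex.ofReal_re]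
    positivity
  add_left := finner_add_left
  smul_left f g c := finner_smul_left c f g
  definite f h := by
    rw [finner_self, Complex.ofReal_eq_zero,
      Finset.sum_eq_zero_iff_of_nonneg (fun _ _ => by positivity)] at h
    ext m
    by_cases hm : m ∈ f.support
    · simpa using h m hm
    · simpa using hm

instance fockNACG : NormedAddCommGroup Fock :=
  @InnerProductSpace.Core.toNormedAddCommGroup ℂ Fock _ _ _ fockCore

instance fockIPS : InnerProductSpace ℂ Fock := InnerProductSpace.ofCore fockCore.toCore

theorem inner_eq (f g : Fock) : inner ℂ f g = finner f g := rfl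

/-- Annihilation operators indexed by mode. -/
def an (i : Bool) : Module.End ℂ Fock := if i then a1 else a2
/-- Creation operators indexed by mode. -/
def cr (i : Bool) : Module.End ℂ Fock := if i then a1d else a2d

theorem ccr (i : Bool) (f : Fock) : an i (cr i f) = cr i (an i f) + f := by
  cases i
  · exact ccr22 f
  · exact ccr11 f

theorem adj (i : Bool) (f g : Fock) : inner ℂ (cr i f) g = inner ℂ f (an i g) := by
  cases i
  · exact adj2 f g
  · exact adj1 f g

theorem adj' (i : Bool) (f g : Fock) : inner ℂ (an i f) g = inner ℂ f (cr i g) := by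
  rw [← inner_conj_symm, ← adj, inner_conj_symm]

theorem numOp_eq (f : Fock) : numOp f = cr true (an true f) + cr false (an false f) := rfl

theorem num_an (i : Bool) (f : Fock) : numOp (an i f) = an i (numOp f) - an i f := by
  cases i
  · change a1d (a1 (a2 f)) + a2d (a2 (a2 f)) = a2 (a1d (a1 f) + a2d (a2 f)) - a2 f
    rw [map_add, ccr22, ccr21, caa]; abel
  · change a1d (a1 (a1 f)) + a2d (a2 (a1 f)) = a1 (a1d (a1 f) + a2d (a2 f)) - a1 f
    rw [map_add, ccr11, ccr12, caa]; abel

theorem num_cr (i : Bool) (f : Fock) : numOp (cr i f) = cr i (numOp f) + cr i f := by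
  cases i
  · change a1d (a1 (a2d f)) + a2d (a2 (a2d f)) = a2d (a1d (a1 f) + a2d (a2 f)) + a2d f
    rw [map_add, ccr22, ccr12, cdd, map_add]; abel
  · change a1d (a1 (a1d f)) + a2d (a2 (a1d f)) = a1d (a1d (a1 f) + a2d (a2 f)) + a1d f
    rw [map_add, ccr11, ccr21, map_add, cdd]; abel

/-- The `r`-particle sector. -/
def Sec (r : ℝ) (f : Fock) : Prop := numOp f = (r : ℂ) • f

theorem Sec.an {r : ℝ} {f : Fock} (h : Sec r f) (i : Bool) : Sec (r - 1) (an i f) := by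
  unfold Sec at *
  rw [num_an, h, map_smul, Complex.ofReal_sub, sub_smul]; simp

theorem Sec.cr {r : ℝ} {f : Fock} (h : Sec r f) (i : Bool) : Sec (r + 1) (cr i f) := by
  unfold Sec at *
  rw [num_cr, h, map_smul, Complex.ofReal_add, add_smul]; simp

theorem Sec.add {r : ℝ} {f g : Fock} (h : Sec r f) (h' : Sec r g) : Sec r (f + g) := by
  unfold Sec at *; rw [map_add, h, h', smul_add]

theorem Sec.smul {r : ℝ} {f : Fock} (h : Sec r f) (c : ℂ) : Sec r (c • f) := by
  unfold Sec at *; rw [map_smul, h, smul_comm]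

theorem sec_sq {r : ℝ} {f : Fock} (h : Sec r f) :
    ‖an true f‖ ^ 2 + ‖an false f‖ ^ 2 = r * ‖f‖ ^ 2 := by
  have e : inner ℂ f (numOp f) = (r : ℂ) * ((‖f‖ : ℂ) ^ 2) := by
    rw [h, inner_smul_right, inner_self_eq_norm_sq_to_K]; rfl
  rw [numOp_eq, inner_add_right, ← adj', ← adj', inner_self_eq_norm_sq_to_K,
    inner_self_eq_norm_sq_to_K] at e
  simp only [Complex.coe_algebraMap] at e
  exact_mod_cast e

theorem Sec.norm_an_sq {r : ℝ} {f : Fock} (h : Sec r f) (i : Bool) :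
    ‖_root_.an i f‖ ^ 2 ≤ r * ‖f‖ ^ 2 := by
  have := sec_sq h
  cases i
  · nlinarith [sq_nonneg ‖_root_.an true f‖]
  · nlinarith [sq_nonneg ‖_root_.an false f‖]

theorem norm_cr_sq (i : Bool) (f : Fock) : ‖cr i f‖ ^ 2 = ‖an i f‖ ^ 2 + ‖f‖ ^ 2 := by
  have e : inner ℂ (cr i f) (cr i f) = inner ℂ (an i f) (an i f) + inner ℂ f f := by
    rw [adj, ccr, inner_add_right, ← adj']
  rw [inner_self_eq_norm_sq_to_K, inner_self_eq_norm_sq_to_K, inner_self_eq_norm_sq_to_K] at e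
  simp only [Complex.coe_algebraMap] at e
  exact_mod_cast e

theorem Sec.norm_an {r s : ℝ} {f : Fock} (h : Sec r f) (hs : 0 ≤ s) (hr : r ≤ s ^ 2) (i : Bool) :
    ‖_root_.an i f‖ ≤ s * ‖f‖ := by
  refine (sq_le_sq₀ (norm_nonneg _) (by positivity)).mp ?_
  have := h.norm_an_sq i
  nlinarith [sq_nonneg ‖f‖]

theorem Sec.norm_cr {r s : ℝ} {f : Fock} (h : Sec r f) (hs : 0 ≤ s) (hr : r + 1 ≤ s ^ 2)
    (i : Bool) : ‖_root_.cr i f‖ ≤ s * ‖f‖ := by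
  refine (sq_le_sq₀ (norm_nonneg _) (by positivity)).mp ?_
  have := h.norm_an_sq i
  rw [norm_cr_sq]
  nlinarith [sq_nonneg ‖f‖]

theorem norm_E {r s : ℝ} {f : Fock} (h : Sec r f) (hs : 0 ≤ s) (hr : r ≤ s ^ 2) (i j : Bool) :
    ‖cr i (an j f)‖ ≤ s ^ 2 * ‖f‖ := by
  have h1 := h.norm_an hs hr j
  have h2 := (h.an j).norm_cr hs (by linarith) i
  calc _ ≤ s * ‖an j f‖ := h2
    _ ≤ s * (s * ‖f‖) := by gcongr
    _ = _ := by ring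

theorem norm_P {r s : ℝ} {f : Fock} (h : Sec r f) (hs : 0 ≤ s) (hr : r ≤ s ^ 2) (i : Bool) :
    ‖cr i (cr i (an i (an i f)))‖ ≤ s ^ 4 * ‖f‖ := by
  have h1 := h.norm_an hs hr i
  have h2 := norm_E (h.an i) hs (by linarith) i i
  have h3 := (((h.an i).an i).cr i).norm_cr hs (by linarith) i
  calc _ ≤ s * ‖cr i (an i (an i f))‖ := h3
    _ ≤ s * (s ^ 2 * (s * ‖f‖)) := by gcongr; exact h2.trans (by gcongr)
    _ = _ := by ring

/-- The generic coherent state. -/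
def psi (u : Bool → ℂ) : ℕ → Fock
  | 0 => vacuum
  | N + 1 => ((Real.sqrt (N + 1) : ℝ) : ℂ)⁻¹ •
      (u true • cr true (psi u N) + u false • cr false (psi u N))

theorem coherent_eq (N : ℕ) (θ φ : ℝ) : coherent N θ φ =
    psi (fun i => if i then (Real.cos (θ / 2) : ℂ) else
      (Complex.exp (Complex.I * φ) * (Real.sin (θ / 2) : ℂ))) N := by
  induction N with
  | zero => simp [coherent, psi]
  | succ N ih =>
    rw [psi, ← ih]
    simp only [coherent, pow_succ', Module.End.mul_apply, Nat.factorial_succ, Nat.cast_mul]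
    rw [Real.sqrt_mul (by positivity)]
    simp [cr, smul_smul, smul_add]
    module

theorem psi_succ (u : Bool → ℂ) (N : ℕ) : ((Real.sqrt (N + 1) : ℝ) : ℂ) • psi u (N + 1) =
    u true • cr true (psi u N) + u false • cr false (psi u N) := by
  have : ((Real.sqrt (N + 1) : ℝ) : ℂ) ≠ 0 := by
    rw [Complex.ofReal_ne_zero]; positivity
  rw [psi, smul_smul, mul_inv_cancel₀ this, one_smul]

theorem an_vacuum (i : Bool) : an i vacuum = 0 := by
  cases i
  · change a2 (Finsupp.single (0, 0) 1) = 0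
    simp [a2_single]
  · change a1 (Finsupp.single (0, 0) 1) = 0
    simp [a1_single]

theorem an_cr_ne (i j : Bool) (h : i ≠ j) (f : Fock) : an i (cr j f) = cr j (an i f) := by
  cases i <;> cases j
  · simp at h
  · exact ccr21 f
  · exact ccr12 f
  · simp at h

theorem sec_psi (u : Bool → ℂ) (N : ℕ) : Sec N (psi u N) := by
  induction N with
  | zero => simp [Sec, psi, numOp_eq, an_vacuum]
  | succ N ih =>
    rw [psi]; push_cast
    exact (((ih.cr true).smul _).add ((ih.cr false).smul _)).smul _

theorem sqrt_ne (N : ℕ) : ((Real.sqrt (N + 1) : ℝ) : ℂ) ≠ 0 := by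
  rw [Complex.ofReal_ne_zero]; positivity

theorem an_psi (u : Bool → ℂ) (N : ℕ) (i : Bool) :
    an i (psi u (N + 1)) = (((Real.sqrt (N + 1) : ℝ) : ℂ) * u i) • psi u N := by
  have key : an i (u true • cr true (psi u N) + u false • cr false (psi u N)) =
      ((N + 1 : ℂ) * u i) • psi u N := by
    have comm : an i (u true • cr true (psi u N) + u false • cr false (psi u N)) =
      u true • cr true (an i (psi u N)) + u false • cr false (an i (psi u N)) + u i • psi u N := by
      rw [map_add, map_smul, map_smul]
      cases i
      · rw [ccr, an_cr_ne _ _ (by simp)]; module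
      · rw [ccr, an_cr_ne _ _ (by simp)]; module
    rw [comm]
    cases N with
    | zero => simp [psi, an_vacuum]
    | succ N =>
      rw [an_psi u N i]
      have := psi_succ u N
      have e := sqrt_mul_self_c N
      simp only [map_smul]
      rw [smul_comm (u true), smul_comm (u false), ← smul_add, ← this, smul_smul, ← add_smul]
      congr 1
      push_cast
      linear_combination u i * e
  rw [psi, map_smul, key, smul_smul]
  congr 1
  rw [← sqrt_mul_self_c]
  field_simp [sqrt_ne N]

theorem norm_psi (u : Bool → ℂ) (hu : ‖u true‖ ^ 2 + ‖u false‖ ^ 2 = 1) (N : ℕ) :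
    ‖psi u N‖ = 1 := by
  have h : inner ℂ (psi u N) (psi u N) = (1 : ℂ) := by
    induction N with
    | zero => 
      rw [inner_eq]
      simp [psi, vacuum, finner_single]
    | succ N ih =>
      have hu' : (starRingEnd ℂ) (u true) * u true + (starRingEnd ℂ) (u false) * u false = 1 := by
        rw [Complex.conj_mul', Complex.conj_mul']; exact_mod_cast hu
      apply mul_left_cancel₀ (sqrt_ne N)
      rw [← inner_smul_right, psi_succ, inner_add_right, inner_smul_right, inner_smul_right,
        ← adj', ← adj', an_psi, an_psi, inner_smul_left, inner_smul_left, ih]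
      simp only [map_mul, Complex.conj_ofReal]
      linear_combination ((Real.sqrt (N + 1) : ℝ) : ℂ) * hu'
  rw [inner_self_eq_norm_sq_to_K] at h
  simp only [Complex.coe_algebraMap] at h
  have h : ‖psi u N‖ ^ 2 = 1 := by exact_mod_cast h
  nlinarith [norm_nonneg (psi u N)]

/-- The error vector of a creation operator on a coherent state. -/
def er (u : Bool → ℂ) (i : Bool) (N : ℕ) : Fock :=
  cr i (psi u N) - (((Real.sqrt (N + 1) : ℝ) : ℂ) * (starRingEnd ℂ) (u i)) • psi u (N + 1)

theorem cr_psi (u : Bool → ℂ) (i : Bool) (N : ℕ) : cr i (psi u N) =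
    (((Real.sqrt (N + 1) : ℝ) : ℂ) * (starRingEnd ℂ) (u i)) • psi u (N + 1) + er u i N := by
  simp [er]

theorem sec_er (u : Bool → ℂ) (i : Bool) (N : ℕ) : Sec (N + 1) (er u i N) := by
  have := ((sec_psi u N).cr i).add
    ((sec_psi u (N+1)).smul (-(((Real.sqrt (N + 1) : ℝ) : ℂ) * (starRingEnd ℂ) (u i))) |> fun h => by push_cast at h; exact h)
  rw [er, sub_eq_add_neg, ← neg_smul]
  exact this

theorem norm_er (u : Bool → ℂ) (hu : ‖u true‖ ^ 2 + ‖u false‖ ^ 2 = 1) (i : Bool) (N : ℕ) :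
    ‖er u i N‖ ≤ 1 := by
  have hn := norm_psi u hu
  have ha : ‖an i (psi u N)‖ ^ 2 = N * ‖u i‖ ^ 2 := by
    cases N with
    | zero => simp [psi, an_vacuum]
    | succ N =>
      rw [an_psi, norm_smul, hn, norm_mul, Complex.norm_real, mul_one, mul_pow, Real.norm_eq_abs,
        sq_abs, Real.sq_sqrt (by positivity)]
      push_cast; rfl
  have hx : inner ℂ (cr i (psi u N))
      ((((Real.sqrt (N + 1) : ℝ) : ℂ) * (starRingEnd ℂ) (u i)) • psi u (N + 1)) =
      (((N + 1) * ‖u i‖ ^ 2 : ℝ) : ℂ) := by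
    rw [adj, map_smul, an_psi, inner_smul_right, inner_smul_right, inner_self_eq_norm_sq_to_K, hn]
    have e := sqrt_mul_self_c N
    have e2 := Complex.conj_mul' (u i)
    push_cast
    linear_combination (starRingEnd ℂ (u i)) * u i * e + (N + 1) * e2
  have h := @norm_sub_sq ℂ _ _ _ _ (cr i (psi u N))
    ((((Real.sqrt (N + 1) : ℝ) : ℂ) * (starRingEnd ℂ) (u i)) • psi u (N + 1))
  rw [hx, norm_cr_sq, ha, norm_smul, hn, hn, norm_mul, Complex.norm_real, RCLike.norm_conj,
    mul_one, mul_pow, Real.norm_eq_abs, sq_abs, Real.sq_sqrt (by positivity)] at h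
  simp only [RCLike.re_to_complex, Complex.ofReal_re] at h
  have h' : ‖er u i N‖ ^ 2 = 1 - ‖u i‖ ^ 2 := by rw [er, h]; ring
  nlinarith [sq_nonneg ‖u i‖, norm_nonneg (er u i N)]

theorem norm_u (u : Bool → ℂ) (hu : ‖u true‖ ^ 2 + ‖u false‖ ^ 2 = 1) (i : Bool) : ‖u i‖ ≤ 1 := by
  cases i
  · nlinarith [sq_nonneg ‖u true‖, norm_nonneg (u false)]
  · nlinarith [sq_nonneg ‖u false‖, norm_nonneg (u true)]

theorem E_psi (u : Bool → ℂ) (hu : ‖u true‖ ^ 2 + ‖u false‖ ^ 2 = 1) (i j : Bool) (N : ℕ) :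
    ‖cr i (an j (psi u (N + 1))) - ((N + 1 : ℂ) * ((starRingEnd ℂ) (u i) * u j)) • psi u (N + 1)‖
      ≤ Real.sqrt (N + 1) := by
  have e := sqrt_mul_self_c N
  have : cr i (an j (psi u (N + 1))) -
      ((N + 1 : ℂ) * ((starRingEnd ℂ) (u i) * u j)) • psi u (N + 1) =
      (((Real.sqrt (N + 1) : ℝ) : ℂ) * u j) • er u i N := by
    rw [an_psi, map_smul, cr_psi, ← e]
    module
  rw [this, norm_smul, norm_mul, Complex.norm_real, Real.norm_eq_abs,
    abs_of_nonneg (Real.sqrt_nonneg _)]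
  calc _ ≤ Real.sqrt (N + 1) * 1 * 1 := by
        gcongr
        · exact norm_u u hu j
        · exact norm_er u hu i N
    _ = _ := by ring

theorem P_psi (u : Bool → ℂ) (hu : ‖u true‖ ^ 2 + ‖u false‖ ^ 2 = 1) (i : Bool) (k : ℕ) (s : ℝ)
    (hs : s = Real.sqrt (k + 2)) :
    ‖cr i (cr i (an i (an i (psi u (k + 2))))) -
      ((s : ℂ) ^ 4 * ((starRingEnd ℂ) (u i) * u i) ^ 2) • psi u (k + 2)‖
      ≤ 3 * s ^ 3 := by
  obtain ⟨t, ht⟩ : ∃ t, t = Real.sqrt ((k : ℝ) + 1) := ⟨_, rfl⟩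
  have hs' : Real.sqrt (((k + 1 : ℕ) : ℝ) + 1) = s := by rw [hs]; push_cast; ring_nf
  have hs2 : s ^ 2 = k + 2 := by rw [hs, Real.sq_sqrt (by positivity)]
  have ht2 : t ^ 2 = k + 1 := by rw [ht, Real.sq_sqrt (by positivity)]
  have hs0 : 0 ≤ s := by rw [hs]; positivity
  have ht0 : 0 ≤ t := by rw [ht]; positivity
  have hts : t ≤ s := by rw [ht, hs]; apply Real.sqrt_le_sqrt; linarith
  have hs1 : 1 ≤ s := by nlinarith [(Nat.cast_nonneg k : (0:ℝ) ≤ k)]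
  have hc : (s : ℂ) ^ 2 - (t : ℂ) ^ 2 = 1 := by
    have : s ^ 2 - t ^ 2 = 1 := by rw [hs2, ht2]; ring
    exact_mod_cast this
  set v := (starRingEnd ℂ) (u i) with hv
  have hvn : ‖v‖ ≤ 1 := by rw [hv, RCLike.norm_conj]; exact norm_u u hu i
  have hun := norm_u u hu i
  have key : cr i (cr i (an i (an i (psi u (k + 2))))) -
      ((s : ℂ) ^ 4 * (v * u i) ^ 2) • psi u (k + 2) =
      ((s : ℂ) * t * u i ^ 2 * (t * v)) • er u i (k + 1) +
      ((s : ℂ) * t * u i ^ 2) • cr i (er u i k) + (-((s : ℂ) ^ 2 * (v * u i) ^ 2)) • psi u (k + 2) := by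
    rw [an_psi u (k + 1), map_smul, an_psi u k, hs', ← ht]
    simp only [map_smul]
    rw [cr_psi u i k, map_add, map_smul, cr_psi u i (k + 1), hs', ← ht, ← hv]
    have : (s : ℂ) ^ 4 = (s : ℂ) ^ 2 * t ^ 2 + s ^ 2 := by linear_combination (s : ℂ) ^ 2 * hc
    rw [this]
    module
  have h1 := norm_er u hu i (k + 1)
  have h2 : ‖cr i (er u i k)‖ ≤ s * 1 :=
    ((sec_er u i k).norm_cr hs0 (by rw [hs2]; linarith) i).trans (by gcongr; exact norm_er u hu i k)
  rw [key]
  refine (norm_add₃_le).trans ?_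
  simp only [norm_smul, norm_mul, norm_neg, norm_pow, Complex.norm_real, Real.norm_eq_abs,
    abs_of_nonneg hs0, abs_of_nonneg ht0, norm_psi u hu]
  calc _ ≤ s * s * 1 ^ 2 * (s * 1) * 1 + s * s * 1 ^ 2 * (s * 1) + s ^ 2 * (1 * 1) ^ 2 * 1 := by
        gcongr
    _ ≤ _ := by nlinarith [sq_nonneg s]

theorem exp_bound (L : Module.End ℂ Fock) (ψ : Fock) (w : ℂ) (M η r : ℝ)
    (hM : 1 ≤ M) (hw : ‖w‖ ≤ M)
    (hL : ∀ f, Sec r f → Sec r (L f)) (hLn : ∀ f, Sec r f → ‖L f‖ ≤ M * ‖f‖)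
    (hψ : Sec r ψ) (hψ1 : ‖ψ‖ = 1) (hη : ‖L ψ - w • ψ‖ ≤ η) :
    ‖(∑' j : ℕ, ((j.factorial : ℂ))⁻¹ * finner ψ ((L ^ j) ψ)) - Complex.exp w‖
      ≤ Real.exp (2 * M) * η := by
  have hη0 : 0 ≤ η := (norm_nonneg _).trans hη
  have hsec : ∀ j : ℕ, Sec r ((L ^ j) ψ) := by
    intro j
    induction j with
    | zero => simpa using hψ
    | succ j ih => rw [pow_succ', Module.End.mul_apply]; exact hL _ ih
  have hd : ∀ j : ℕ, ‖(L ^ j) ψ - w ^ j • ψ‖ ≤ (2 * M) ^ j * η := by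
    intro j
    induction j with
    | zero => simpa using hη0
    | succ j ih =>
      have e : (L ^ (j + 1)) ψ - w ^ (j + 1) • ψ =
          L ((L ^ j) ψ - w ^ j • ψ) + w ^ j • (L ψ - w • ψ) := by
        rw [pow_succ', Module.End.mul_apply, map_sub, map_smul]; module
      have hs : Sec r ((L ^ j) ψ - w ^ j • ψ) := by
        rw [sub_eq_add_neg, ← neg_smul]; exact (hsec j).add (hψ.smul _)
      rw [e]
      calc _ ≤ ‖L ((L ^ j) ψ - w ^ j • ψ)‖ + ‖w ^ j • (L ψ - w • ψ)‖ := norm_add_le _ _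
        _ ≤ M * ((2 * M) ^ j * η) + M ^ j * η := by
          rw [norm_smul, norm_pow]
          gcongr
          exact (hLn _ hs).trans (by gcongr)
        _ ≤ M * ((2 * M) ^ j * η) + M * ((2 * M) ^ j * η) := by
          refine add_le_add le_rfl ?_
          calc M ^ j * η ≤ (2 * M) ^ j * η := by gcongr; linarith
            _ ≤ M * ((2 * M) ^ j * η) := le_mul_of_one_le_left (by positivity) hM
        _ = _ := by ring
  have hg : HasSum (fun j : ℕ => ((j.factorial : ℂ))⁻¹ * w ^ j) (Complex.exp w) := by
    have := NormedSpace.expSeries_div_hasSum_exp (𝔸 := ℂ) w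
    rw [← Complex.exp_eq_exp_ℂ] at this
    simpa [div_eq_inv_mul] using this
  have hb : HasSum (fun j : ℕ => ((j.factorial : ℝ))⁻¹ * ((2 * M) ^ j * η))
      (Real.exp (2 * M) * η) := by
    have := NormedSpace.expSeries_div_hasSum_exp (𝔸 := ℝ) (2 * M)
    rw [← Real.exp_eq_exp_ℝ] at this
    simpa [div_eq_inv_mul, mul_assoc] using this.mul_right η
  have hbd : ∀ j : ℕ, ‖((j.factorial : ℂ))⁻¹ * finner ψ ((L ^ j) ψ) -
      ((j.factorial : ℂ))⁻¹ * w ^ j‖ ≤ ((j.factorial : ℝ))⁻¹ * ((2 * M) ^ j * η) := by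
    intro j
    have e : finner ψ ((L ^ j) ψ) - w ^ j = inner ℂ ψ ((L ^ j) ψ - w ^ j • ψ) := by
      rw [inner_sub_right, inner_smul_right, inner_self_eq_norm_sq_to_K, hψ1, inner_eq]; simp
    rw [← mul_sub, norm_mul, norm_inv, Complex.norm_natCast, e]
    gcongr
    calc _ ≤ ‖ψ‖ * _ := norm_inner_le_norm _ _
      _ ≤ _ := by rw [hψ1, one_mul]; exact hd j
  have hsum := Summable.of_norm_bounded hb.summable hbd
  have hs2 := hsum.add hg.summable
  simp only [sub_add_cancel] at hs2
  rw [← hg.tsum_eq, ← hs2.tsum_sub hg.summable]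
  exact tsum_of_norm_bounded hb hbd

theorem ham_apply (δ ε kT : ℝ) (hkT : 0 < kT) (N : ℕ) (f : Fock) :
    ((-(kT : ℂ)⁻¹) • H_BH (δ * kT / N) (2 * ε * kT / (N : ℝ) ^ 2)) f =
    ((δ / N : ℝ) : ℂ) • (cr true (an false f) + cr false (an true f)) +
    ((-(ε / N ^ 2) : ℝ) : ℂ) • (cr true (cr true (an true (an true f))) +
      cr false (cr false (an false (an false f)))) := by
  have hk : (kT : ℂ) ≠ 0 := by exact_mod_cast hkT.ne'
  change (-(kT : ℂ)⁻¹) • ((-((δ * kT / N : ℝ) : ℂ)) • (cr true (an false f) + cr false (an true f)) +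
    (((2 * ε * kT / (N : ℝ) ^ 2 : ℝ) : ℂ) / 2) • (cr true (cr true (an true (an true f))) +
      cr false (cr false (an false (an false f))))) = _
  rw [smul_add, smul_smul, smul_smul]
  congr 2
  · push_cast; field_simp
  · push_cast; field_simp

theorem generic_limit (δ ε kT : ℝ) (hkT : 0 < kT) (u : Bool → ℂ)
    (hu : ‖u true‖ ^ 2 + ‖u false‖ ^ 2 = 1) (w : ℂ)
    (hw : w = δ * ((starRingEnd ℂ) (u true) * u false + (starRingEnd ℂ) (u false) * u true) -
      ε * (((starRingEnd ℂ) (u true) * u true) ^ 2 + ((starRingEnd ℂ) (u false) * u false) ^ 2)) :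
    Filter.Tendsto
      (fun N : ℕ => expMatrixEl kT (H_BH (δ * kT / N) (2 * ε * kT / (N : ℝ) ^ 2)) (psi u N))
      Filter.atTop (nhds (Complex.exp w)) := by
  set M : ℝ := 1 + 2 * |δ| + 2 * |ε| + ‖w‖ with hM
  have hlim : Filter.Tendsto (fun N : ℕ => Real.exp (2 * M) *
      ((2 * |δ| + 6 * |ε|) * (Real.sqrt N)⁻¹)) Filter.atTop (nhds 0) := by
    have h1 : Filter.Tendsto (fun N : ℕ => (Real.sqrt N)⁻¹) Filter.atTop (nhds 0) :=
      (Real.tendsto_sqrt_atTop.comp tendsto_natCast_atTop_atTop).inv_tendsto_atTop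
    simpa using (h1.const_mul (2 * |δ| + 6 * |ε|)).const_mul (Real.exp (2 * M))
  rw [tendsto_iff_norm_sub_tendsto_zero]
  refine squeeze_zero' (Filter.Eventually.of_forall fun _ => norm_nonneg _) ?_ hlim
  filter_upwards [Filter.eventually_ge_atTop 2] with N hN
  obtain ⟨k, rfl⟩ := Nat.exists_eq_add_of_le' hN
  obtain ⟨s, hs⟩ : ∃ s, s = Real.sqrt ((k + 2 : ℕ) : ℝ) := ⟨_, rfl⟩
  have hs2 : s ^ 2 = ((k + 2 : ℕ) : ℝ) := by rw [hs, Real.sq_sqrt (by positivity)]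
  have hs0 : 0 < s := by rw [hs]; positivity
  rw [← hs]
  have hnδ : ‖((δ / s ^ 2 : ℝ) : ℂ)‖ = |δ| / s ^ 2 := by
    rw [Complex.norm_real, Real.norm_eq_abs, abs_div, abs_of_nonneg (sq_nonneg s)]
  have hnε : ‖((-(ε / (s ^ 2) ^ 2) : ℝ) : ℂ)‖ = |ε| / s ^ 4 := by
    rw [Complex.norm_real, Real.norm_eq_abs, abs_neg, abs_div, abs_of_nonneg (sq_nonneg (s ^ 2))]
    ring_nf
  refine exp_bound _ _ w M _ ((k + 2 : ℕ) : ℝ) ?_ ?_ ?_ ?_ (sec_psi u _) (norm_psi u hu _) ?_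
  · rw [hM]; linarith [abs_nonneg δ, abs_nonneg ε, norm_nonneg w]
  · rw [hM]; linarith [abs_nonneg δ, abs_nonneg ε, norm_nonneg w]
  · intro f hf
    rw [ham_apply _ _ _ hkT]
    have hE : ∀ i j, Sec ((k + 2 : ℕ) : ℝ) (cr i (an j f)) := fun i j => by
      simpa using (hf.an j).cr i
    have hP : ∀ i, Sec ((k + 2 : ℕ) : ℝ) (cr i (cr i (an i (an i f)))) := fun i => by
      simpa using ((((hf.an i).an i).cr i).cr i)
    exact (((hE _ _).add (hE _ _)).smul _).add (((hP _).add (hP _)).smul _)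
  · intro f hf
    rw [ham_apply _ _ _ hkT, ← hs2]
    have hE := norm_E hf hs0.le hs2.ge
    have hP := norm_P hf hs0.le hs2.ge
    calc _ ≤ |δ| / s ^ 2 * (s ^ 2 * ‖f‖ + s ^ 2 * ‖f‖) +
          |ε| / s ^ 4 * (s ^ 4 * ‖f‖ + s ^ 4 * ‖f‖) := by
          refine (norm_add_le _ _).trans ?_
          rw [norm_smul, norm_smul, hnδ, hnε]
          gcongr
          · exact (norm_add_le _ _).trans (add_le_add (hE _ _) (hE _ _))
          · exact (norm_add_le _ _).trans (add_le_add (hP _) (hP _))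
      _ = (2 * |δ| + 2 * |ε|) * ‖f‖ := by field_simp; ring
      _ ≤ _ := by
        gcongr
        rw [hM]; linarith [norm_nonneg w]
  · rw [ham_apply _ _ _ hkT, ← hs2]
    have hE : ∀ i j, ‖cr i (an j (psi u (k + 2))) -
        ((s : ℂ) ^ 2 * ((starRingEnd ℂ) (u i) * u j)) • psi u (k + 2)‖ ≤ s := fun i j => by
      have h := E_psi u hu i j (k + 1)
      have h1 : (((k + 1 : ℕ) : ℂ) + 1) = (s : ℂ) ^ 2 := by
        rw [← Complex.ofReal_pow, hs2]; push_cast; ring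
      have h2 : Real.sqrt (((k + 1 : ℕ) : ℝ) + 1) = s := by rw [hs]; push_cast; ring_nf
      rw [h1, h2] at h
      exact h
    have hP := fun i => P_psi u hu i k s (by rw [hs]; push_cast; rfl)
    have hsc : (s : ℂ) ≠ 0 := by exact_mod_cast hs0.ne'
    set ψ := psi u (k + 2)
    have key : ∀ A B C D : Fock,
      ((δ / s ^ 2 : ℝ) : ℂ) • (A + B) + ((-(ε / (s ^ 2) ^ 2) : ℝ) : ℂ) • (C + D) - w • ψ =
      ((δ / s ^ 2 : ℝ) : ℂ) • ((A - ((s : ℂ) ^ 2 * ((starRingEnd ℂ) (u true) * u false)) • ψ) +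
        (B - ((s : ℂ) ^ 2 * ((starRingEnd ℂ) (u false) * u true)) • ψ)) +
      ((-(ε / (s ^ 2) ^ 2) : ℝ) : ℂ) •
        ((C - ((s : ℂ) ^ 4 * ((starRingEnd ℂ) (u true) * u true) ^ 2) • ψ) +
        (D - ((s : ℂ) ^ 4 * ((starRingEnd ℂ) (u false) * u false) ^ 2) • ψ)) := by
      intro A B C D
      have h1 : ((δ / s ^ 2 : ℝ) : ℂ) * (s : ℂ) ^ 2 = δ := by push_cast; field_simp
      have h2 : ((-(ε / (s ^ 2) ^ 2) : ℝ) : ℂ) * (s : ℂ) ^ 4 = -ε := by push_cast; field_simp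
      have hw' : w = (((δ / s ^ 2 : ℝ) : ℂ) * (s : ℂ) ^ 2) *
          ((starRingEnd ℂ) (u true) * u false + (starRingEnd ℂ) (u false) * u true) +
          (((-(ε / (s ^ 2) ^ 2) : ℝ) : ℂ) * (s : ℂ) ^ 4) *
          (((starRingEnd ℂ) (u true) * u true) ^ 2 + ((starRingEnd ℂ) (u false) * u false) ^ 2) := by
        rw [h1, h2, hw]; ring
      rw [hw']
      module
    rw [key]
    calc _ ≤ |δ| / s ^ 2 * (s + s) + |ε| / s ^ 4 * (3 * s ^ 3 + 3 * s ^ 3) := by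
          refine (norm_add_le _ _).trans ?_
          rw [norm_smul, norm_smul, hnδ, hnε]
          gcongr
          · exact (norm_add_le _ _).trans (add_le_add (hE _ _) (hE _ _))
          · exact (norm_add_le _ _).trans (add_le_add (hP _) (hP _))
      _ = _ := by field_simp; ring

/-- pointwise convergence of the coherent-state matrix elements
of the canonical ensemble: with the Bose-Hubbard Hamiltonian scaled so that
`NJ/(k_BT) = δ` and `N²U/(2k_BT) = ε` are fixed,
`⟨Ψ^N_{θ,φ}| e^{−H_N/k_BT} |Ψ^N_{θ,φ}⟩ → exp(δ sinθ cosφ − (ε/2)cos²θ − ε/2)`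
as `N → ∞`. -/
theorem canonical_matrix_element_limit (δ ε kT : ℝ) (hkT : 0 < kT) (θ φ : ℝ) :
    Filter.Tendsto
      (fun N : ℕ =>
        expMatrixEl kT (H_BH (δ * kT / N) (2 * ε * kT / (N : ℝ) ^ 2))
          (coherent N θ φ))
      Filter.atTop
      (nhds (Complex.exp
        (((δ * (Real.sin θ * Real.cos φ) - ε / 2 * Real.cos θ ^ 2 - ε / 2 : ℝ)
          : ℂ)))) := by

  simp only [coherent_eq]
  have hpre : ‖Complex.exp (Complex.I * φ)‖ = 1 := by
    rw [mul_comm]; exact Complex.norm_exp_ofReal_mul_I φ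
  refine generic_limit δ ε kT hkT _ ?_ _ ?_
  · simp only [if_true, Bool.false_eq_true, if_false]
    rw [norm_mul, hpre, Complex.norm_real, Complex.norm_real, Real.norm_eq_abs, Real.norm_eq_abs,
      one_mul, sq_abs, sq_abs, Real.cos_sq_add_sin_sq]
  · simp only [if_true, Bool.false_eq_true, if_false, map_mul, Complex.conj_ofReal]
    have he : (starRingEnd ℂ) (Complex.exp (Complex.I * φ)) * Complex.exp (Complex.I * φ) = 1 := by
      rw [Complex.conj_mul', hpre]; simp
    have hsum : Complex.exp (Complex.I * φ) + (starRingEnd ℂ) (Complex.exp (Complex.I * φ))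
        = 2 * (Real.cos φ : ℂ) := by
      rw [Complex.add_conj, mul_comm Complex.I, Complex.exp_ofReal_mul_I_re]; push_cast; ring
    have h1 : Real.sin θ = 2 * Real.sin (θ / 2) * Real.cos (θ / 2) := by
      rw [← Real.sin_two_mul]; ring_nf
    have h2 : Real.cos θ = Real.cos (θ / 2) ^ 2 - Real.sin (θ / 2) ^ 2 := by
      rw [← Real.cos_two_mul']; ring_nf
    have h3 := Real.cos_sq_add_sin_sq (θ / 2)
    rw [h1, h2]
    generalize Real.cos (θ / 2) = c at *
    generalize Real.sin (θ / 2) = s at *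
    generalize Real.cos φ = x at *
    generalize Complex.exp (Complex.I * φ) = z at *
    generalize (starRingEnd ℂ) z = z' at *
    have h3' : (c : ℂ) ^ 2 + (s : ℂ) ^ 2 = 1 := by exact_mod_cast h3
    have e1 : (z' * (s : ℂ) * (z * s)) = s ^ 2 := by linear_combination (s : ℂ) ^ 2 * he
    rw [e1]
    push_cast
    linear_combination (-(δ : ℂ) * c * s) * hsum + (ε / 2 : ℂ) * (c ^ 2 + s ^ 2 + 1) * h3'
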